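/- Let n ∈ ℕ and let X : EuclideanSpace ℝ (Fin n) → EuclideanSpace ℝ (Fin n) be a smooth (C^∞) vector field whose total derivative is skew-symmetric at every point, i.e., ⟨(fderiv ℝ X p) u, v⟩ + ⟨u, (fderiv ℝ X p) v⟩ = 0 for all p, u, v ∈ EuclideanSpace ℝ (Fin n). If X vanishes on some nonempty open subset U of EuclideanSpace ℝ (Fin n), then X vanishes identically. -/

import Mathlib

open scoped RealInnerProductSpace

/-- A smooth vector field on Euclidean space whose total derivative is everywhere
skew-symmetric (i.e., a Killing field for the Euclidean metric) that vanishes on a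
nonempty open set vanishes identically. -/
theorem killing_field_unique_continuation
    (n : ℕ) (X : EuclideanSpace ℝ (Fin n) → EuclideanSpace ℝ (Fin n))
    (hX : ContDiff ℝ (⊤ : ℕ∞) X)
    (hskew : ∀ p u v : EuclideanSpace ℝ (Fin n),
      ⟪fderiv ℝ X p u, v⟫ + ⟪u, fderiv ℝ X p v⟫ = 0)
    (U : Set (EuclideanSpace ℝ (Fin n))) (hU : IsOpen U) (hUne : U.Nonempty)
    (hvan : ∀ x ∈ U, X x = 0) :
    ∀ x, X x = 0 := by
  intro x
  -- along lines, the component of `X` in the direction of the line is constant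
  have key : ∀ y ∈ U, ⟪X x, x - y⟫ = 0 := by
    intro y hy
    have hd : ∀ t : ℝ, HasDerivAt (fun t : ℝ => ⟪X (y + t • (x - y)), x - y⟫) 0 t := by
      intro t
      have h1 : HasDerivAt (fun t : ℝ => y + t • (x - y)) (x - y) t := by
        simpa using ((hasDerivAt_id t).smul_const (x - y)).const_add y
      have h2 : HasFDerivAt X (fderiv ℝ X (y + t • (x - y))) (y + t • (x - y)) :=
        ((hX.differentiable (by simp)) _).hasFDerivAt
      have h3 := (h2.comp_hasDerivAt t h1).inner ℝ (hasDerivAt_const t (x - y))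
      have h4 := hskew (y + t • (x - y)) (x - y) (x - y)
      rw [real_inner_comm (fderiv ℝ X (y + t • (x - y)) (x - y)) (x - y)] at h4
      have h5 : ⟪fderiv ℝ X (y + t • (x - y)) (x - y), x - y⟫ = 0 := by
        rw [real_inner_comm] at h4 ⊢
        linarith
      rw [h5, inner_zero_right, zero_add] at h3
      exact h3
    have hc := is_const_of_deriv_eq_zero (fun t => (hd t).differentiableAt)
      (fun t => (hd t).deriv) 1 0
    simpa [hvan y hy] using hc
  obtain ⟨y, hy⟩ := hUne
  have hcont : Filter.Tendsto (fun t : ℝ => y + t • X x) (nhdsWithin 0 {0}ᶜ) (nhds y) := by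
    have : Continuous (fun t : ℝ => y + t • X x) := by fun_prop
    have h := this.tendsto 0
    simp only [zero_smul, add_zero] at h
    exact h.mono_left nhdsWithin_le_nhds
  obtain ⟨t, ht, ht0⟩ :=
    ((hcont.eventually (hU.mem_nhds hy)).and self_mem_nhdsWithin).exists
  have e1 := key y hy
  have e2 := key _ ht
  rw [← sub_sub, inner_sub_right, e1, inner_smul_right] at e2
  have ht1 : t ≠ 0 := ht0
  simpa [ht1] using e2
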